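/- Let K be a commutative ring, n ≥ 1, let X = (x_{i,j}) be an n×n upper unitriangular matrix over K (x_{i,i} = 1 and x_{i,j} = 0 for i > j), and let H = diag(λ₁,…,λₙ). Then for all indices i < j the (i,j) entry of X⁻¹HX equals (λ_i − λ_j)·x_{i,j} + Σ_{t=1}^{j−i−1} (−1)ᵗ · Σ_{i<k₁<k₂<⋯<k_t<j} (λ_{k_t} − λ_j)·x_{i,k₁}·x_{k₁,k₂}·⋯·x_{k_t,j}. Moreover the diagonal entries of X⁻¹HX are λ₁,…,λₙ and the entries below the diagonal vanish. -/

import Mathlib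

/-!
Statement 9. For an upper unitriangular matrix `X = (x_{i,j})` over a commutative ring
and `H = diag(λ₁,…,λₙ)`, the (i,j) entry of `X⁻¹HX` for `i < j` equals
`(λ_i − λ_j)x_{i,j} + Σ_{t=1}^{j−i−1} (−1)ᵗ Σ_{i<k₁<⋯<k_t<j} (λ_{k_t} − λ_j)
x_{i,k₁}x_{k₁,k₂}⋯x_{k_t,j}`; the inner sums over chains `i<k₁<⋯<k_t<j` are encoded as
sums over nonempty subsets `T` of the interval `Ioo i j` (with `t = |T|`, `k_t = max T`,
and the product taken along the sorted chain `i :: sort T ++ [j]`). Moreover the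
diagonal entries of `X⁻¹HX` are `λ₁,…,λₙ` and the entries below the diagonal vanish.
-/

/-- The product `x_{l₀,l₁} x_{l₁,l₂} ⋯` along the consecutive pairs of a list `l`. -/
def chainProd {K : Type*} [CommRing K] {n : ℕ} (X : Matrix (Fin n) (Fin n) K)
    (l : List (Fin n)) : K :=
  ((l.zip l.tail).map fun q => X q.1 q.2).prod

theorem chainProd_cons_cons' {K : Type*} [CommRing K] {n : ℕ} (X : Matrix (Fin n) (Fin n) K)
    (a b : Fin n) (l : List (Fin n)) :
    chainProd X (a :: b :: l) = X a b * chainProd X (b :: l) := by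
  simp [chainProd]

theorem chainProd_snoc {K : Type*} [CommRing K] {n : ℕ} (X : Matrix (Fin n) (Fin n) K)
    (l : List (Fin n)) (i k j : Fin n) :
    chainProd X (i :: ((l ++ [k]) ++ [j])) = chainProd X (i :: (l ++ [k])) * X k j := by
  induction l generalizing i with
  | nil => simp [chainProd]
  | cons a l ih =>
    simp only [List.cons_append, chainProd_cons_cons'] at ih ⊢
    rw [ih, mul_assoc]

theorem sort_insert_max {n : ℕ} (S : Finset (Fin n)) (k : Fin n) (h : ∀ a ∈ S, a < k) :
    (insert k S).sort (· ≤ ·) = S.sort (· ≤ ·) ++ [k] := by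
  have hk : k ∉ S := fun hh => lt_irrefl _ (h k hh)
  have hs : List.Pairwise (· ≤ ·) (S.sort (· ≤ ·) ++ [k]) := by
    rw [List.pairwise_append]
    refine ⟨Finset.pairwise_sort S _, by simp, ?_⟩
    intro a ha b hb
    simp at ha hb
    subst hb
    exact (h a ha).le
  have hn : (S.sort (· ≤ ·) ++ [k]).Nodup := by
    rw [List.nodup_append]
    refine ⟨Finset.sort_nodup S _, by simp, ?_⟩
    intro a ha b hb
    simp at ha hb
    subst hb
    exact (h a ha).ne
  have e : insert k S = (S.sort (· ≤ ·) ++ [k]).toFinset := by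
    ext a; simp [or_comm]
  rw [e]
  exact (List.toFinset_sort (· ≤ ·) hn).2 hs

theorem sum_by_max {K : Type*} [CommRing K] {n : ℕ} (i j : Fin n) (f : Finset (Fin n) → K) :
    ∑ T ∈ (Finset.Ioo i j).powerset.filter (fun T => T.Nonempty), f T =
      ∑ k ∈ Finset.Ioo i j, ∑ S ∈ (Finset.Ioo i k).powerset, f (insert k S) := by
  rw [Finset.sum_sigma']
  symm
  refine Finset.sum_bij (fun p _ => insert p.1 p.2) ?_ ?_ ?_ ?_
  · rintro ⟨k, S⟩ h
    simp only [Finset.mem_sigma, Finset.mem_Ioo, Finset.mem_powerset, Finset.subset_iff,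
      Finset.mem_filter, Finset.mem_insert] at h ⊢
    refine ⟨?_, Finset.insert_nonempty _ _⟩
    rintro a (rfl | ha)
    · exact h.1
    · exact ⟨(h.2 ha).1, (h.2 ha).2.trans h.1.2⟩
  · rintro ⟨k, S⟩ h ⟨k', S'⟩ h' e
    simp only [Finset.mem_sigma, Finset.mem_Ioo, Finset.mem_powerset, Finset.subset_iff] at h h' e
    have hk : k = k' := by
      have h1 : k ∈ insert k' S' := e ▸ Finset.mem_insert_self k S
      have h2 : k' ∈ insert k S := e ▸ Finset.mem_insert_self k' S'
      rw [Finset.mem_insert] at h1 h2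
      rcases h1 with h1 | h1
      · exact h1
      rcases h2 with h2 | h2
      · exact h2.symm
      exact absurd ((h.2 h2).2.trans (h'.2 h1).2) (lt_irrefl _)
    subst hk
    have a1 : k ∉ S := fun hh => lt_irrefl _ (h.2 hh).2
    have a2 : k ∉ S' := fun hh => lt_irrefl _ (h'.2 hh).2
    have : S = S' := by
      rw [← Finset.erase_insert a1, e, Finset.erase_insert a2]
    rw [this]
  · intro T hT
    simp only [Finset.mem_filter, Finset.mem_powerset] at hT
    obtain ⟨hT, hne⟩ := hT
    refine ⟨⟨T.max' hne, T.erase (T.max' hne)⟩, ?_, Finset.insert_erase (T.max'_mem hne)⟩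
    simp only [Finset.mem_sigma, Finset.mem_powerset]
    refine ⟨hT (T.max'_mem hne), fun a ha => ?_⟩
    have := Finset.mem_Ioo.1 (hT (Finset.mem_of_mem_erase ha))
    exact Finset.mem_Ioo.2 ⟨this.1, Finset.lt_max'_of_mem_erase_max' T hne ha⟩
  · intros; rfl

/-- Signed chain sum. -/
def chainInv {K : Type*} [CommRing K] {n : ℕ} (X : Matrix (Fin n) (Fin n) K) :
    Matrix (Fin n) (Fin n) K := fun i k =>
  if i = k then 1 else if i < k then
    ∑ S ∈ (Finset.Ioo i k).powerset,
      (-1 : K) ^ (S.card + 1) * chainProd X (i :: (S.sort (· ≤ ·) ++ [k])) else 0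

theorem sum_chain {K : Type*} [CommRing K] {n : ℕ} (X : Matrix (Fin n) (Fin n) K)
    (g : Fin n → K) (i j : Fin n) :
    ∑ T ∈ (Finset.Ioo i j).powerset.filter (fun T => T.Nonempty),
      (-1 : K) ^ T.card * (g ((T.sort (· ≤ ·)).getLastD i) *
        chainProd X (i :: (T.sort (· ≤ ·) ++ [j]))) =
    ∑ k ∈ Finset.Ioo i j, chainInv X i k * (g k * X k j) := by
  rw [sum_by_max]
  refine Finset.sum_congr rfl fun k hk => ?_
  rw [Finset.mem_Ioo] at hk
  rw [chainInv, if_neg hk.1.ne, if_pos hk.1, Finset.sum_mul]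
  refine Finset.sum_congr rfl fun S hS => ?_
  have h : ∀ a ∈ S, a < k := fun a ha =>
    (Finset.mem_Ioo.1 (Finset.mem_powerset.1 hS ha)).2
  have hk' : k ∉ S := fun hh => lt_irrefl _ (h k hh)
  rw [sort_insert_max S k h, chainProd_snoc, Finset.card_insert_of_notMem hk']
  have : (S.sort (· ≤ ·) ++ [k]).getLastD i = k := by simp
  rw [this]
  ring

theorem sum_upper {K : Type*} [CommRing K] {n : ℕ} (f : Fin n → K) (i j : Fin n) (hij : i < j)
    (h1 : ∀ k, k < i → f k = 0) (h2 : ∀ k, j < k → f k = 0) :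
    ∑ k, f k = f i + ∑ k ∈ Finset.Ioo i j, f k + f j := by
  have : ∑ k, f k = ∑ k ∈ Finset.Icc i j, f k := by
    symm
    apply Finset.sum_subset (Finset.subset_univ _)
    intro k _ hk
    rw [Finset.mem_Icc, not_and_or, not_le, not_le] at hk
    exact hk.elim (h1 k) (h2 k)
  rw [this, ← Finset.Ioc_insert_left hij.le, Finset.sum_insert (by simp),
    ← Finset.Ioo_insert_right hij, Finset.sum_insert (by simp)]
  ring

theorem chainInv_low {K : Type*} [CommRing K] {n : ℕ} (X : Matrix (Fin n) (Fin n) K)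
    (i k : Fin n) (h : k < i) : chainInv X i k = 0 := by
  rw [chainInv, if_neg h.ne', if_neg h.not_gt]

theorem chainInv_diag {K : Type*} [CommRing K] {n : ℕ} (X : Matrix (Fin n) (Fin n) K)
    (i : Fin n) : chainInv X i i = 1 := by
  rw [chainInv, if_pos rfl]

theorem chainInv_rec {K : Type*} [CommRing K] {n : ℕ} (X : Matrix (Fin n) (Fin n) K)
    (i j : Fin n) (hij : i < j) :
    chainInv X i j = - (X i j + ∑ k ∈ Finset.Ioo i j, chainInv X i k * X k j) := by
  have h := sum_chain X (fun _ => 1) i j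
  simp only [one_mul] at h
  rw [← h, chainInv, if_neg hij.ne, if_pos hij,
    ← Finset.sum_filter_add_sum_filter_not _ (fun T : Finset (Fin n) => T.Nonempty)]
  have e : (Finset.Ioo i j).powerset.filter (fun T => ¬ T.Nonempty) = {∅} := by
    ext T
    simp only [Finset.mem_filter, Finset.mem_powerset, Finset.not_nonempty_iff_eq_empty,
      Finset.mem_singleton]
    exact ⟨fun h => h.2, fun h => ⟨by simp [h], h⟩⟩
  rw [e, Finset.sum_singleton, neg_add, ← Finset.sum_neg_distrib, add_comm]
  congr 1
  · simp [chainProd]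
  · refine Finset.sum_congr rfl fun T _ => ?_
    ring

theorem conj_low {K : Type*} [CommRing K] {n : ℕ} (X Y : Matrix (Fin n) (Fin n) K)
    (hlow : ∀ i j : Fin n, j < i → X i j = 0) (hY : ∀ i j : Fin n, j < i → Y i j = 0)
    (g : Fin n → K) (i j : Fin n) (h : j < i) : ∑ k, Y i k * (g k * X k j) = 0 := by
  refine Finset.sum_eq_zero fun k _ => ?_
  rcases lt_or_ge k i with hk | hk
  · rw [hY _ _ hk, zero_mul]
  · rw [hlow _ _ (h.trans_le hk), mul_zero, mul_zero]

theorem conj_diag {K : Type*} [CommRing K] {n : ℕ} (X Y : Matrix (Fin n) (Fin n) K)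
    (hlow : ∀ i j : Fin n, j < i → X i j = 0) (hY : ∀ i j : Fin n, j < i → Y i j = 0)
    (hd : ∀ i, X i i = 1) (hd' : ∀ i, Y i i = 1)
    (g : Fin n → K) (i : Fin n) : ∑ k, Y i k * (g k * X k i) = g i := by
  rw [Finset.sum_eq_single i]
  · rw [hd, hd', one_mul, mul_one]
  · intro k _ hk
    rcases lt_or_gt_of_ne hk with hk | hk
    · rw [hY _ _ hk, zero_mul]
    · rw [hlow _ _ hk, mul_zero, mul_zero]
  · simp

theorem chainInv_mul {K : Type*} [CommRing K] {n : ℕ} (X : Matrix (Fin n) (Fin n) K)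
    (hdiag : ∀ i, X i i = 1) (hlow : ∀ i j : Fin n, j < i → X i j = 0) :
    chainInv X * X = 1 := by
  ext i j
  rw [Matrix.mul_apply]
  rcases lt_trichotomy i j with h | rfl | h
  · rw [Matrix.one_apply_ne h.ne, sum_upper _ i j h, chainInv_rec X i j h, chainInv_diag, hdiag]
    · ring
    · intro k hk; rw [chainInv_low X _ _ hk, zero_mul]
    · intro k hk; rw [hlow _ _ hk, mul_zero]
  · simpa using conj_diag X _ hlow (chainInv_low X) hdiag (chainInv_diag X) (fun _ => 1) i
  · rw [Matrix.one_apply_ne h.ne']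
    simpa using conj_low X _ hlow (chainInv_low X) (fun _ => 1) i j h

theorem unitriangular_conjugate_diagonal_entries
    {K : Type*} [CommRing K] {n : ℕ}
    (X : Matrix (Fin n) (Fin n) K)
    (hdiag : ∀ i, X i i = 1) (hlow : ∀ i j : Fin n, j < i → X i j = 0)
    (lam : Fin n → K) (H : Matrix (Fin n) (Fin n) K) (hH : H = Matrix.diagonal lam) :
    (∀ i j : Fin n, i < j →
      (X⁻¹ * H * X) i j =
        (lam i - lam j) * X i j +
          ∑ T ∈ (Finset.Ioo i j).powerset.filter (fun T => T.Nonempty),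
            (-1 : K) ^ T.card *
              ((lam ((T.sort (· ≤ ·)).getLastD i) - lam j) *
                chainProd X (i :: (T.sort (· ≤ ·) ++ [j])))) ∧
    (∀ i : Fin n, (X⁻¹ * H * X) i i = lam i) ∧
    (∀ i j : Fin n, j < i → (X⁻¹ * H * X) i j = 0) := by
  have hm := chainInv_mul X hdiag hlow
  have hinv : X⁻¹ = chainInv X := Matrix.inv_eq_left_inv hm
  have key : ∀ i j, (X⁻¹ * H * X) i j = ∑ k, chainInv X i k * (lam k * X k j) := by
    intro i j
    rw [hinv, hH, Matrix.mul_assoc, Matrix.mul_apply]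
    simp only [Matrix.diagonal_mul]
  refine ⟨fun i j hij => ?_, fun i => ?_, fun i j h => ?_⟩
  · have h0 : ∑ k, chainInv X i k * X k j = 0 := by
      rw [← Matrix.mul_apply, hm, Matrix.one_apply_ne hij.ne]
    have h1 : (X⁻¹ * H * X) i j = ∑ k, chainInv X i k * ((lam k - lam j) * X k j) := by
      rw [key, ← sub_zero (∑ k, chainInv X i k * (lam k * X k j)), ← mul_zero (lam j), ← h0,
        Finset.mul_sum, ← Finset.sum_sub_distrib]
      refine Finset.sum_congr rfl fun k _ => ?_
      ring
    rw [h1, sum_chain X (fun k => lam k - lam j) i j, sum_upper _ i j hij, chainInv_diag]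
    · ring
    · intro k hk; rw [chainInv_low X _ _ hk, zero_mul]
    · intro k hk; rw [hlow _ _ hk, mul_zero, mul_zero]
  · rw [key]; exact conj_diag X _ hlow (chainInv_low X) hdiag (chainInv_diag X) lam i
  · rw [key]; exact conj_low X _ hlow (chainInv_low X) lam i j h
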